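/- Let 0 < α < 1 and b_j := (j+1)^{1-α} − j^{1-α} for integers j ≥ 0. Let (E_k)_{k≥0} and (G_k)_{k≥0} be sequences of nonnegative real numbers satisfying: E_0 ≤ G_0; E_1 ≤ E_0 + G_1; and for every integer k ≥ 1, E_{k+1} ≤ (1 − b_1) E_k + ∑_{j=1}^{k-1} (b_j − b_{j+1}) E_{k-j} + b_k E_0 + G_{k+1}. Then for every integer k ≥ 0, E_k ≤ ∑_{j=0}^{k} G_j. -/

import Mathlib

/-- The L1 coefficients `b_j = (j+1)^(1-α) - j^(1-α)`. -/
noncomputable def bcoef (α : ℝ) (j : ℕ) : ℝ :=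
  ((j : ℝ) + 1) ^ (1 - α) - (j : ℝ) ^ (1 - α)

lemma bcoef_zero {α : ℝ} (hα1 : α < 1) : bcoef α 0 = 1 := by
  simp [bcoef, Real.zero_rpow (sub_pos.mpr hα1).ne']

lemma bcoef_nonneg {α : ℝ} (hα1 : α ≤ 1) (j : ℕ) : 0 ≤ bcoef α j :=
  sub_nonneg.mpr <|
    Real.rpow_le_rpow j.cast_nonneg (le_add_of_nonneg_right zero_le_one) (sub_nonneg.mpr hα1)

lemma bcoef_succ_le {α : ℝ} (hα0 : 0 ≤ α) (hα1 : α ≤ 1) (j : ℕ) :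
    bcoef α (j + 1) ≤ bcoef α j := by
  have hj : (0 : ℝ) ≤ j := j.cast_nonneg
  have h := (Real.concaveOn_rpow (p := 1 - α) (by linarith) (by linarith)).2
    (Set.mem_Ici.mpr hj) (Set.mem_Ici.mpr (by linarith : (0 : ℝ) ≤ j + 1 + 1))
    (by norm_num : (0 : ℝ) ≤ 1 / 2) (by norm_num : (0 : ℝ) ≤ 1 / 2) (by norm_num)
  simp only [smul_eq_mul] at h
  rw [show 1 / 2 * (j : ℝ) + 1 / 2 * ((j : ℝ) + 1 + 1) = j + 1 by ring] at h
  simp only [bcoef, Nat.cast_add, Nat.cast_one]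
  linarith

lemma sum_Ico_sub_succ (b : ℕ → ℝ) {m k : ℕ} (h : m ≤ k) :
    ∑ j ∈ Finset.Ico m k, (b j - b (j + 1)) = b m - b k := by
  rw [← neg_inj, ← Finset.sum_neg_distrib, neg_sub, ← Finset.sum_Ico_sub b h]
  simp

theorem discrete_gronwall_sum_bound (α : ℝ) (hα0 : 0 < α) (hα1 : α < 1)
    (E G : ℕ → ℝ) (hE : ∀ k, 0 ≤ E k) (hG : ∀ k, 0 ≤ G k)
    (h0 : E 0 ≤ G 0) (h1 : E 1 ≤ E 0 + G 1)
    (hrec : ∀ k : ℕ, 1 ≤ k →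
      E (k + 1) ≤ (1 - bcoef α 1) * E k
        + (∑ j ∈ Finset.Ico 1 k, (bcoef α j - bcoef α (j + 1)) * E (k - j))
        + bcoef α k * E 0 + G (k + 1)) :
    ∀ k : ℕ, E k ≤ ∑ j ∈ Finset.range (k + 1), G j := by
  have mono : Monotone fun k => ∑ j ∈ Finset.range (k + 1), G j := fun a b hab =>
    Finset.sum_le_sum_of_subset_of_nonneg
      (Finset.range_mono (Nat.succ_le_succ hab)) fun i _ _ => hG i
  intro k
  induction k using Nat.strong_induction_on with
  | _ n ih =>
    match n with
    | 0 => simpa using h0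
    | 1 =>
      rw [Finset.sum_range_succ, Finset.sum_range_one]
      linarith
    | k + 2 =>
      set S := ∑ j ∈ Finset.range (k + 1 + 1), G j with hS
      have hle : ∀ i ≤ k + 1, E i ≤ S := fun i hi =>
        (ih i (Nat.lt_succ_of_le hi)).trans (mono hi)
      have hb1 : 0 ≤ 1 - bcoef α 1 := by
        simpa [bcoef_zero hα1] using bcoef_succ_le hα0.le hα1.le 0
      have hsum : ∑ j ∈ Finset.Ico 1 (k + 1), (bcoef α j - bcoef α (j + 1)) * E (k + 1 - j)
          ≤ (bcoef α 1 - bcoef α (k + 1)) * S := by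
        rw [← sum_Ico_sub_succ (bcoef α) (Nat.le_add_left 1 k), Finset.sum_mul]
        exact Finset.sum_le_sum fun j _ => mul_le_mul_of_nonneg_left (hle _ (Nat.sub_le _ _))
          (sub_nonneg.mpr (bcoef_succ_le hα0.le hα1.le j))
      have hfirst := mul_le_mul_of_nonneg_left (hle (k + 1) le_rfl) hb1
      have hlast := mul_le_mul_of_nonneg_left (hle 0 (Nat.zero_le _))
        (bcoef_nonneg hα1.le (k + 1))
      have hr := hrec (k + 1) (Nat.le_add_left 1 k)
      rw [Finset.sum_range_succ, ← hS]
      linarith
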